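/- arXiv:2505.18863 — 9 statements merged into one kernel-verified Lean document; each statement's English description precedes it below -/
import Mathlib

section
/- Let K be a field and define the operation * on K^3 by (a*b)_0 = a_0 b_0 + (a_1+a_2)(b_1+b_2), (a*b)_1 = a_1 b_0 + (a_0+a_2) b_1 − a_1 b_2, (a*b)_2 = a_2 b_0 − a_2 b_1 + (a_0+a_1) b_2. Then * is associative: (a*b)*c = a*(b*c) for all a, b, c ∈ K^3. -/
/-- The matrix-generated multiplication on `K^3` from the example:
`(a*b)_0 = a_0 b_0 + (a_1+a_2)(b_1+b_2)`, `(a*b)_1 = a_1 b_0 + (a_0+a_2) b_1 - a_1 b_2`,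
`(a*b)_2 = a_2 b_0 - a_2 b_1 + (a_0+a_1) b_2`. -/
def smul3 {K : Type*} [Field K] (a b : Fin 3 → K) : Fin 3 → K :=
  ![a 0 * b 0 + (a 1 + a 2) * (b 1 + b 2),
    a 1 * b 0 + (a 0 + a 2) * b 1 - a 1 * b 2,
    a 2 * b 0 - a 2 * b 1 + (a 0 + a 1) * b 2]

theorem smul3_associative {K : Type*} [Field K] (a b c : Fin 3 → K) :
    smul3 (smul3 a b) c = smul3 a (smul3 b c) := by
  ext i
  fin_cases i <;> simp [smul3] <;> ring
end

section
/- Let K be a field with (2 : K) ≠ 0 and * the operation on K^3 defined by (a*b)_0 = a_0 b_0 + (a_1+a_2)(b_1+b_2), (a*b)_1 = a_1 b_0 + (a_0+a_2) b_1 − a_1 b_2, (a*b)_2 = a_2 b_0 − a_2 b_1 + (a_0+a_1) b_2. Let α, β ∈ K with α ≠ β, and let a, b ∈ K^3 satisfy a_1 = α a_2, b_1 = β b_2, a_2 ≠ 0, b_2 ≠ 0. Then a * b ≠ b * a. -/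
theorem smul3_cross_layer_noncomm {K : Type*} [Field K] (h2 : (2 : K) ≠ 0)
    (α β : K) (hαβ : α ≠ β) (a b : Fin 3 → K)
    (ha : a 1 = α * a 2) (hb : b 1 = β * b 2)
    (ha2 : a 2 ≠ 0) (hb2 : b 2 ≠ 0) :
    smul3 a b ≠ smul3 b a := by
  intro h
  have h1 := congrFun h 1
  simp only [smul3, Matrix.cons_val_one, Matrix.cons_val_zero, ha, hb] at h1
  have key : 2 * (a 2 * b 2 * (β - α)) = 0 := by linear_combination h1
  exact mul_ne_zero h2 (mul_ne_zero (mul_ne_zero ha2 hb2) (sub_ne_zero.mpr hαβ.symm)) key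
end

section
/- Let K be a field and * the operation on K^3 defined by (a*b)_0 = a_0 b_0 + (a_1+a_2)(b_1+b_2), (a*b)_1 = a_1 b_0 + (a_0+a_2) b_1 − a_1 b_2, (a*b)_2 = a_2 b_0 − a_2 b_1 + (a_0+a_1) b_2. Let α, β ∈ K with α ≠ β, and let a, b ∈ K^3 satisfy a_1 = α a_2, b_1 = β b_2, a_2 ≠ 0, b_2 ≠ 0, and additionally a_0 + a_1 + a_2 ≠ 0 and b_0 ≠ b_1 + b_2. Then the product a*b lies outside both operand strata: (a*b)_1 ≠ α (a*b)_2 and (a*b)_1 ≠ β (a*b)_2. -/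
theorem smul3_left_stratum_defect {K : Type*} [Field K] (α β : K) (a b : Fin 3 → K)
    (ha : a 1 = α * a 2) (hb : b 1 = β * b 2) :
    smul3 a b 1 - α * smul3 a b 2 = (β - α) * b 2 * (a 0 + a 1 + a 2) := by
  simp only [smul3, Matrix.cons_val]
  rw [ha, hb]
  ring

theorem smul3_right_stratum_defect {K : Type*} [Field K] (α β : K) (a b : Fin 3 → K)
    (ha : a 1 = α * a 2) (hb : b 1 = β * b 2) :
    smul3 a b 1 - β * smul3 a b 2 = (α - β) * a 2 * (b 0 - b 1 - b 2) := by
  simp only [smul3, Matrix.cons_val]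
  rw [ha, hb]
  ring

theorem smul3_stratum_escape {K : Type*} [Field K]
    (α β : K) (hαβ : α ≠ β) (a b : Fin 3 → K)
    (ha : a 1 = α * a 2) (hb : b 1 = β * b 2)
    (ha2 : a 2 ≠ 0) (hb2 : b 2 ≠ 0)
    (ha0 : a 0 + a 1 + a 2 ≠ 0) (hb0 : b 0 ≠ b 1 + b 2) :
    smul3 a b 1 ≠ α * smul3 a b 2 ∧ smul3 a b 1 ≠ β * smul3 a b 2 := by
  have hα := smul3_left_stratum_defect α β a b ha hb
  have hβ := smul3_right_stratum_defect α β a b ha hb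
  refine ⟨fun h => ?_, fun h => ?_⟩
  · rw [sub_eq_zero.mpr h] at hα
    exact mul_ne_zero (mul_ne_zero (sub_ne_zero.mpr hαβ.symm) hb2) ha0 hα.symm
  · rw [sub_eq_zero.mpr h] at hβ
    refine mul_ne_zero (mul_ne_zero (sub_ne_zero.mpr hαβ) ha2) ?_ hβ.symm
    rwa [sub_sub, sub_ne_zero]
end

section
/- Let K be a field and A, B, C, D, E, F ∈ K. Define the parametric operation * on K^3 by (a*b)_0 = a_0 b_0 + A a_1 b_1 + B a_2 b_2 + C a_2 b_1 + D a_1 b_2, (a*b)_1 = a_1 b_0 + a_0 b_1 + E a_2 b_1 − E a_1 b_2, (a*b)_2 = a_2 b_0 + a_0 b_2 + F a_2 b_1 − F a_1 b_2. If a, b, c ∈ K^3 satisfy the pairwise proportionality conditions a_1 b_2 = a_2 b_1, b_1 c_2 = b_2 c_1, and a_1 c_2 = a_2 c_1, then (a*b)*c = a*(b*c). -/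
/-- The parametric multiplication on `K^3` with parameters `A B C D E F`:
`(a*b)_0 = a_0 b_0 + A a_1 b_1 + B a_2 b_2 + C a_2 b_1 + D a_1 b_2`,
`(a*b)_1 = a_1 b_0 + a_0 b_1 + E a_2 b_1 - E a_1 b_2`,
`(a*b)_2 = a_2 b_0 + a_0 b_2 + F a_2 b_1 - F a_1 b_2`. -/
def pmul3 {K : Type*} [Field K] (A B C D E F : K) (a b : Fin 3 → K) : Fin 3 → K :=
  ![a 0 * b 0 + A * (a 1 * b 1) + B * (a 2 * b 2) + C * (a 2 * b 1) + D * (a 1 * b 2),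
    a 1 * b 0 + a 0 * b 1 + E * (a 2 * b 1) - E * (a 1 * b 2),
    a 2 * b 0 + a 0 * b 2 + F * (a 2 * b 1) - F * (a 1 * b 2)]

theorem pmul3_assoc_of_proportional {K : Type*} [Field K] (A B C D E F : K)
    (a b c : Fin 3 → K)
    (hab : a 1 * b 2 = a 2 * b 1)
    (hbc : b 1 * c 2 = b 2 * c 1)
    (hac : a 1 * c 2 = a 2 * c 1) :
    pmul3 A B C D E F (pmul3 A B C D E F a b) c
      = pmul3 A B C D E F a (pmul3 A B C D E F b c) := by
  ext i
  fin_cases i <;> simp [pmul3] <;> grind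
end

section
/- Let K be a field and A, B, C, D, E, F ∈ K. Define the parametric operation * on K^3 by (a*b)_0 = a_0 b_0 + A a_1 b_1 + B a_2 b_2 + C a_2 b_1 + D a_1 b_2, (a*b)_1 = a_1 b_0 + a_0 b_1 + E a_2 b_1 − E a_1 b_2, (a*b)_2 = a_2 b_0 + a_0 b_2 + F a_2 b_1 − F a_1 b_2. If b, c ∈ K^3 satisfy b_1 c_2 = b_2 c_1, then for every a ∈ K^3 the Layered Permutation Symmetry operator vanishes: (a*b)*c = (a*c)*b. -/
theorem pmul3_lps_vanishes {K : Type*} [Field K] (A B C D E F : K)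
    (b c : Fin 3 → K) (hbc : b 1 * c 2 = b 2 * c 1) (a : Fin 3 → K) :
    pmul3 A B C D E F (pmul3 A B C D E F a b) c
      = pmul3 A B C D E F (pmul3 A B C D E F a c) b := by
  ext i
  fin_cases i <;> simp only [pmul3, Fin.zero_eta, Fin.mk_one, Fin.reduceFinMk,
    Matrix.cons_val_zero, Matrix.cons_val_one, Matrix.cons_val]
  · linear_combination
      (B * F * a 2 + D * (a 0 + E * a 2) + A * E * a 1 - C * (a 0 - F * a 1)) * hbc
  · linear_combination
      (-E * (a 0 + E * a 2) - (B * a 2 + D * a 1 + E * (a 0 - F * a 1))) * hbc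
  · linear_combination
      (A * a 1 + C * a 2 - F * (a 0 + E * a 2) - F * (a 0 - F * a 1)) * hbc
end

section
/- Let K be a field and A, B, C, D, E, F ∈ K, with * the parametric operation on K^3 defined by (a*b)_0 = a_0 b_0 + A a_1 b_1 + B a_2 b_2 + C a_2 b_1 + D a_1 b_2, (a*b)_1 = a_1 b_0 + a_0 b_1 + E a_2 b_1 − E a_1 b_2, (a*b)_2 = a_2 b_0 + a_0 b_2 + F a_2 b_1 − F a_1 b_2. Suppose b, c, d ∈ K^3 satisfy the pairwise proportionality conditions b_1 c_2 = b_2 c_1, b_1 d_2 = b_2 d_1, and c_1 d_2 = c_2 d_1. Then for every a ∈ K^3 the fully left-associated product ((a*b)*c)*d is invariant under every permutation of (b, c, d); in particular ((a*b)*c)*d = ((a*d)*c)*b. -/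
/-- Right multiplications by proportional vectors commute. -/
theorem pmul3_right_comm {K : Type*} [Field K] (A B C D E F : K) {b c : Fin 3 → K}
    (h : b 1 * c 2 = b 2 * c 1) (a : Fin 3 → K) :
    pmul3 A B C D E F (pmul3 A B C D E F a b) c
      = pmul3 A B C D E F (pmul3 A B C D E F a c) b := by
  ext i
  fin_cases i <;> simp [pmul3]
  · linear_combination (B * F * a 2 + D * (a 0 + E * a 2)
      - (-(A * E * a 1) + C * (a 0 - F * a 1))) * h
  · linear_combination (-(E * (a 0 + E * a 2))
      - (B * a 2 + D * a 1 + E * (a 0 - F * a 1))) * h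
  · linear_combination (A * a 1 + C * a 2 - F * (a 0 + E * a 2)
      - F * (a 0 - F * a 1)) * h

theorem pmul3_perm_invariance {K : Type*} [Field K] (A B C D E F : K)
    (b c d : Fin 3 → K)
    (hbc : b 1 * c 2 = b 2 * c 1)
    (hbd : b 1 * d 2 = b 2 * d 1)
    (hcd : c 1 * d 2 = c 2 * d 1)
    (a : Fin 3 → K) :
    (∀ σ : Equiv.Perm (Fin 3),
        pmul3 A B C D E F
            (pmul3 A B C D E F (pmul3 A B C D E F a (![b, c, d] (σ 0))) (![b, c, d] (σ 1)))
            (![b, c, d] (σ 2))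
          = pmul3 A B C D E F (pmul3 A B C D E F (pmul3 A B C D E F a b) c) d) ∧
      pmul3 A B C D E F (pmul3 A B C D E F (pmul3 A B C D E F a d) c) b
        = pmul3 A B C D E F (pmul3 A B C D E F (pmul3 A B C D E F a b) c) d := by
  have swap_bc (x) := pmul3_right_comm A B C D E F hbc x
  have swap_bd (x) := pmul3_right_comm A B C D E F hbd x
  have swap_cd (x) := pmul3_right_comm A B C D E F hcd x
  have reverse : pmul3 A B C D E F (pmul3 A B C D E F (pmul3 A B C D E F a d) c) b
      = pmul3 A B C D E F (pmul3 A B C D E F (pmul3 A B C D E F a b) c) d := by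
    rw [← swap_cd, ← swap_bd, swap_bc]
  refine ⟨fun σ => ?_, reverse⟩
  have h01 : σ 0 ≠ σ 1 := σ.injective.ne (by decide)
  have h02 : σ 0 ≠ σ 2 := σ.injective.ne (by decide)
  have h12 : σ 1 ≠ σ 2 := σ.injective.ne (by decide)
  generalize σ 0 = i at *
  generalize σ 1 = j at *
  generalize σ 2 = k at *
  fin_cases i <;> fin_cases j <;> fin_cases k <;> first
    | exact absurd rfl h01
    | exact absurd rfl h02
    | exact absurd rfl h12
    | skip
  · rfl
  · exact (swap_cd _).symm
  · exact congrArg (pmul3 A B C D E F · d) (swap_bc a).symm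
  · exact (swap_bd _).symm.trans (congrArg (pmul3 A B C D E F · d) (swap_bc a).symm)
  · exact (congrArg (pmul3 A B C D E F · c) (swap_bd a).symm).trans (swap_cd _).symm
  · exact reverse
end

section
/- Let K be a field and A, B, C, D, E, F ∈ K, with * the operation on K^4 defined by (a*b)_0 = a_0 b_0 + (A a_1 + E a_2) b_1 + (B a_2 + C a_1) b_2 − A B a_3 b_3; (a*b)_1 = a_1 b_0 + (a_0 + F a_3) b_1 + B a_3 b_2 + (D a_1 − B a_2) b_3; (a*b)_2 = a_2 b_0 − A a_3 b_1 + (a_0 + D a_3) b_2 + (A a_1 + F a_2) b_3; (a*b)_3 = a_3 b_0 − a_2 b_1 + a_1 b_2 + (a_0 + (D+F) a_3) b_3. If a, b ∈ K^4 satisfy a_1 b_2 = a_2 b_1, a_1 b_3 = a_3 b_1, and a_2 b_3 = a_3 b_2, then a * b = b * a. -/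
/-- The parametric multiplication on `K^4` with parameters `A B C D E F`:
`(a*b)_0 = a_0 b_0 + (A a_1 + E a_2) b_1 + (B a_2 + C a_1) b_2 - A B a_3 b_3`,
`(a*b)_1 = a_1 b_0 + (a_0 + F a_3) b_1 + B a_3 b_2 + (D a_1 - B a_2) b_3`,
`(a*b)_2 = a_2 b_0 - A a_3 b_1 + (a_0 + D a_3) b_2 + (A a_1 + F a_2) b_3`,
`(a*b)_3 = a_3 b_0 - a_2 b_1 + a_1 b_2 + (a_0 + (D + F) a_3) b_3`. -/
def pmul4 {K : Type*} [Field K] (A B C D E F : K) (a b : Fin 4 → K) : Fin 4 → K :=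
  ![a 0 * b 0 + (A * a 1 + E * a 2) * b 1 + (B * a 2 + C * a 1) * b 2 - A * B * (a 3 * b 3),
    a 1 * b 0 + (a 0 + F * a 3) * b 1 + B * (a 3 * b 2) + (D * a 1 - B * a 2) * b 3,
    a 2 * b 0 - A * (a 3 * b 1) + (a 0 + D * a 3) * b 2 + (A * a 1 + F * a 2) * b 3,
    a 3 * b 0 - a 2 * b 1 + a 1 * b 2 + (a 0 + (D + F) * a 3) * b 3]

theorem pmul4_comm_of_proportional {K : Type*} [Field K] (A B C D E F : K)
    (a b : Fin 4 → K)
    (h12 : a 1 * b 2 = a 2 * b 1)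
    (h13 : a 1 * b 3 = a 3 * b 1)
    (h23 : a 2 * b 3 = a 3 * b 2) :
    pmul4 A B C D E F a b = pmul4 A B C D E F b a := by
  funext i
  fin_cases i
  · simp [pmul4]
    linear_combination (C - E) * h12
  · simp [pmul4]
    linear_combination (D - F) * h13 - 2 * B * h23
  · simp [pmul4]
    linear_combination 2 * A * h13 + (F - D) * h23
  · simp [pmul4]
    linear_combination 2 * h12
end

section
/- Let K be a field, A, B, C, D, E, F ∈ K, and α', α'' ∈ K, with * the operation on K^4 defined by (a*b)_0 = a_0 b_0 + (A a_1 + E a_2) b_1 + (B a_2 + C a_1) b_2 − A B a_3 b_3; (a*b)_1 = a_1 b_0 + (a_0 + F a_3) b_1 + B a_3 b_2 + (D a_1 − B a_2) b_3; (a*b)_2 = a_2 b_0 − A a_3 b_1 + (a_0 + D a_3) b_2 + (A a_1 + F a_2) b_3; (a*b)_3 = a_3 b_0 − a_2 b_1 + a_1 b_2 + (a_0 + (D+F) a_3) b_3. If a, b, c ∈ K^4 all satisfy v_1 = α'α'' v_3 and v_2 = α'' v_3, then (a*b)*c = a*(b*c). -/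
theorem pmul4_assoc_in_stratum {K : Type*} [Field K] (A B C D E F : K)
    (α' α'' : K) (a b c : Fin 4 → K)
    (ha1 : a 1 = α' * α'' * a 3) (ha2 : a 2 = α'' * a 3)
    (hb1 : b 1 = α' * α'' * b 3) (hb2 : b 2 = α'' * b 3)
    (hc1 : c 1 = α' * α'' * c 3) (hc2 : c 2 = α'' * c 3) :
    pmul4 A B C D E F (pmul4 A B C D E F a b) c
      = pmul4 A B C D E F a (pmul4 A B C D E F b c) := by
  ext i
  fin_cases i <;> simp [pmul4, ha1, ha2, hb1, hb2, hc1, hc2] <;> ring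
end

section
/- Let K be a field and A, B, C, D, E, F ∈ K, with * the operation on K^4 defined by (a*b)_0 = a_0 b_0 + (A a_1 + E a_2) b_1 + (B a_2 + C a_1) b_2 − A B a_3 b_3; (a*b)_1 = a_1 b_0 + (a_0 + F a_3) b_1 + B a_3 b_2 + (D a_1 − B a_2) b_3; (a*b)_2 = a_2 b_0 − A a_3 b_1 + (a_0 + D a_3) b_2 + (A a_1 + F a_2) b_3; (a*b)_3 = a_3 b_0 − a_2 b_1 + a_1 b_2 + (a_0 + (D+F) a_3) b_3. If b, c ∈ K^4 satisfy b_1 c_2 = b_2 c_1, b_1 c_3 = b_3 c_1, and b_2 c_3 = b_3 c_2, then for every a ∈ K^4 the Layered Permutation Symmetry operator vanishes: (a*b)*c = (a*c)*b. -/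
theorem pmul4_lps_vanishes {K : Type*} [Field K] (A B C D E F : K)
    (b c : Fin 4 → K)
    (h12 : b 1 * c 2 = b 2 * c 1)
    (h13 : b 1 * c 3 = b 3 * c 1)
    (h23 : b 2 * c 3 = b 3 * c 2)
    (a : Fin 4 → K) :
    pmul4 A B C D E F (pmul4 A B C D E F a b) c
      = pmul4 A B C D E F (pmul4 A B C D E F a c) b := by
  funext i
  fin_cases i <;> simp [pmul4] <;> grind
end
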